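/- Let C ≥ 0, let v : ℝ^d → ℝ be bounded, Lipschitz, and C-semiconvex, let h be a C² function with compact support, and let τ ∈ (0,1] be such that v + τh is also C-semiconvex. Let φ and φ^τ be the Hopf–Lax functions for quadratic cost with terminal data v and v + τh respectively. Then ∫_{ℝ^d} |φ^τ(0,x) − φ(0,x)| dx ≤ τ e^{dC} ∫_{ℝ^d} |h(x)| dx. -/

import Mathlib

open MeasureTheory Set Real

/-- The Hopf–Lax function for quadratic cost with terminal datum `v` at time `1`:
`φ(t,x) = sup_y ( v(y) - |x-y|²/(2(1-t)) )` for `t < 1`, and `φ(1,x) = v(x)`. -/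
noncomputable def hopfLax (d : ℕ) (v : EuclideanSpace ℝ (Fin d) → ℝ)
    (t : ℝ) (x : EuclideanSpace ℝ (Fin d)) : ℝ :=
  if t = 1 then v x
  else ⨆ y : EuclideanSpace ℝ (Fin d), (v y - ‖x - y‖ ^ 2 / (2 * (1 - t)))

lemma hl_touch {E : Type*} [NormedAddCommGroup E] [InnerProductSpace ℝ E]
    (C : ℝ) (hC : 0 ≤ C) (v : E → ℝ)
    (hv : ConvexOn ℝ univ (fun x => v x + (C / 2) * ‖x‖ ^ 2)) (x y e : E)
    (hy : ∀ z, v z - ‖x - z‖ ^ 2 / 2 ≤ v y - ‖x - y‖ ^ 2 / 2) :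
    v y - inner ℝ (x - y) e - C / 2 * ‖e‖ ^ 2 ≤ v (y + e) := by
  have key : ∀ t : ℝ, 0 < t →
      v y ≤ inner ℝ (x - y) e + v (y + e) + C / 2 * ‖e‖ ^ 2 + t * ((1 + C) * ‖e‖ ^ 2 / 2) := by
    intro t ht
    have h1 := hv.2 (mem_univ (y - t • e)) (mem_univ (y + e))
      (show 0 ≤ 1 / (1 + t) by positivity) (show 0 ≤ t / (1 + t) by positivity) (by field_simp)
    have h2 : (1 / (1 + t)) • (y - t • e) + (t / (1 + t)) • (y + e) = y := by
      have : (1 / (1 + t)) * t = t / (1 + t) := by field_simp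
      have h3 : (1 / (1 + t)) + t / (1 + t) = 1 := by field_simp
      rw [smul_sub, smul_smul, this, smul_add]
      calc _ = ((1 / (1 + t)) + t / (1 + t)) • y := by rw [add_smul]; abel
        _ = y := by rw [h3, one_smul]
    rw [h2] at h1
    have h4 := hy (y - t • e)
    have n1 : ‖y - t • e‖ ^ 2 = ‖y‖ ^ 2 - 2 * (t * inner ℝ y e) + t ^ 2 * ‖e‖ ^ 2 := by
      rw [norm_sub_sq_real, inner_smul_right, norm_smul, mul_pow, Real.norm_eq_abs, sq_abs]
    have n2 : ‖y + e‖ ^ 2 = ‖y‖ ^ 2 + 2 * inner ℝ y e + ‖e‖ ^ 2 := norm_add_sq_real _ _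
    have n3 : ‖x - (y - t • e)‖ ^ 2
        = ‖x - y‖ ^ 2 + 2 * (t * inner ℝ (x - y) e) + t ^ 2 * ‖e‖ ^ 2 := by
      rw [show x - (y - t • e) = (x - y) + t • e by abel, norm_add_sq_real, inner_smul_right,
        norm_smul, mul_pow, Real.norm_eq_abs, sq_abs]
    simp only [smul_eq_mul] at h1
    rw [n1, n2] at h1
    rw [n3] at h4
    have h5 : (1 + t) * (v y + C / 2 * ‖y‖ ^ 2) ≤
        (v (y - t • e) + C / 2 * (‖y‖ ^ 2 - 2 * (t * inner ℝ y e) + t ^ 2 * ‖e‖ ^ 2))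
        + t * (v (y + e) + C / 2 * (‖y‖ ^ 2 + 2 * inner ℝ y e + ‖e‖ ^ 2)) := by
      have := mul_le_mul_of_nonneg_left h1 (show 0 ≤ 1 + t by positivity)
      refine this.trans (le_of_eq ?_)
      field_simp
    have h6 : t * v y ≤ t * (inner ℝ (x - y) e + v (y + e) + C / 2 * ‖e‖ ^ 2
        + t * ((1 + C) * ‖e‖ ^ 2 / 2)) := by nlinarith
    exact le_of_mul_le_mul_left h6 ht
  have : v y ≤ inner ℝ (x - y) e + v (y + e) + C / 2 * ‖e‖ ^ 2 := by
    refine le_of_forall_pos_le_add fun ε hε => ?_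
    have hM : 0 ≤ (1 + C) * ‖e‖ ^ 2 / 2 := by positivity
    have := key (ε / ((1 + C) * ‖e‖ ^ 2 / 2 + 1)) (by positivity)
    refine this.trans ?_
    gcongr
    rw [div_mul_eq_mul_div, div_le_iff₀ (by positivity)]
    nlinarith
  linarith

lemma hl_anti {E : Type*} [NormedAddCommGroup E] [InnerProductSpace ℝ E]
    (C : ℝ) (hC : 0 ≤ C) (v : E → ℝ)
    (hv : ConvexOn ℝ univ (fun x => v x + (C / 2) * ‖x‖ ^ 2)) (x y x' y' : E)
    (hy : ∀ z, v z - ‖x - z‖ ^ 2 / 2 ≤ v y - ‖x - y‖ ^ 2 / 2)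
    (hy' : ∀ z, v z - ‖x' - z‖ ^ 2 / 2 ≤ v y' - ‖x' - y'‖ ^ 2 / 2) :
    ‖x - x'‖ ≤ (1 + C) * ‖y - y'‖ := by
  have hK : 0 < 1 + C := by positivity
  obtain ⟨e, he⟩ : ∃ e : E, x' = x + (1 + C) • e :=
    ⟨(1 + C)⁻¹ • (x' - x), by rw [smul_inv_smul₀ hK.ne']; abel⟩
  obtain ⟨a, ha⟩ : ∃ a : E, a = x - y := ⟨_, rfl⟩
  obtain ⟨b, hb⟩ : ∃ b : E, b = x' - y' := ⟨_, rfl⟩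
  have t1 := hl_touch C hC v hv x y e hy
  have t2 := hl_touch C hC v hv x' y' (-e) hy'
  have m1 := hy' (y + e)
  have m2 := hy (y' + -e)
  have r1 : x' - (y + e) = a + C • e := by rw [he, ha, add_smul, one_smul]; abel
  have r2 : x - (y' + -e) = b - C • e := by
    rw [hb, he, add_smul, one_smul]; abel
  rw [r1, ← hb, norm_add_sq_real, inner_smul_right, norm_smul, mul_pow, Real.norm_eq_abs,
    sq_abs] at m1
  rw [r2, ← ha, norm_sub_sq_real, inner_smul_right, norm_smul, mul_pow, Real.norm_eq_abs,
    sq_abs] at m2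
  rw [← ha] at t1
  rw [← hb, inner_neg_right, norm_neg] at t2
  have s : (1 + C) * (inner ℝ b e - inner ℝ a e) ≤ (1 + C) * (C * ‖e‖ ^ 2) := by nlinarith
  have s' := le_of_mul_le_mul_left s hK
  have yy : y' - y = (1 + C) • e - (b - a) := by rw [hb, ha, he]; abel
  have s2 : ‖e‖ ^ 2 ≤ inner ℝ (y' - y) e := by
    rw [yy, inner_sub_left, inner_sub_left, inner_smul_left, real_inner_self_eq_norm_sq]
    simp only [conj_trivial]
    linarith
  have s3 := s2.trans (real_inner_le_norm _ _)
  have s4 : ‖e‖ ≤ ‖y' - y‖ := by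
    rcases (norm_nonneg e).eq_or_lt with h0 | h0
    · rw [← h0]; positivity
    · exact le_of_mul_le_mul_right (by rw [← sq]; exact s3) h0
  rw [norm_sub_rev x x', norm_sub_rev y y', he, add_sub_cancel_left, norm_smul,
    Real.norm_of_nonneg hK.le]
  gcongr

lemma hl_max {d : ℕ} (v : EuclideanSpace ℝ (Fin d) → ℝ) (hc : Continuous v) (B : ℝ)
    (hB : ∀ x, |v x| ≤ B) (x : EuclideanSpace ℝ (Fin d)) :
    ∃ y, ∀ z, v z - ‖x - z‖ ^ 2 / 2 ≤ v y - ‖x - y‖ ^ 2 / 2 := by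
  have hcont : Continuous fun z => v z - ‖x - z‖ ^ 2 / 2 := by fun_prop
  refine hcont.exists_forall_ge' x ?_
  have hev := (isCompact_closedBall x (4 * B + 1)).compl_mem_cocompact
  filter_upwards [hev] with z hz
  simp only [mem_compl_iff, Metric.mem_closedBall, not_le, dist_eq_norm] at hz
  rw [norm_sub_rev] at hz
  have h1 := abs_le.1 (hB x)
  have h2 := abs_le.1 (hB z)
  simp only [sub_self, norm_zero]
  nlinarith [norm_nonneg (x - z)]

lemma hl_bdd {d : ℕ} (v : EuclideanSpace ℝ (Fin d) → ℝ) (B : ℝ)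
    (hB : ∀ x, |v x| ≤ B) (x : EuclideanSpace ℝ (Fin d)) :
    BddAbove (range fun y => v y - ‖x - y‖ ^ 2 / 2) := by
  refine ⟨B, ?_⟩
  rintro _ ⟨y, rfl⟩
  have := abs_le.1 (hB y)
  have : 0 ≤ ‖x - y‖ ^ 2 := by positivity
  simp only
  linarith

lemma hl_eq {d : ℕ} (v : EuclideanSpace ℝ (Fin d) → ℝ) (x : EuclideanSpace ℝ (Fin d)) :
    hopfLax d v 0 x = ⨆ y, (v y - ‖x - y‖ ^ 2 / 2) := by
  simp [hopfLax]

lemma hl_meas {d : ℕ} (v : EuclideanSpace ℝ (Fin d) → ℝ) (B : ℝ)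
    (hB : ∀ x, |v x| ≤ B) : Measurable (hopfLax d v 0) := by
  have : LowerSemicontinuous fun x => ⨆ y, (v y - ‖x - y‖ ^ 2 / 2) := by
    refine lowerSemicontinuous_ciSup (hl_bdd v B hB) fun y => ?_
    exact Continuous.lowerSemicontinuous (by fun_prop)
  rw [funext (hl_eq v)]
  exact this.measurable

lemma hl_vol {d : ℕ} (K : NNReal) (Y : EuclideanSpace ℝ (Fin d) → EuclideanSpace ℝ (Fin d))
    (hY : AntilipschitzWith K Y) (s : Set (EuclideanSpace ℝ (Fin d))) :
    volume (Y ⁻¹' s) ≤ (K : ENNReal) ^ d * volume s := by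
  have h0 := isAddHaarMeasure_hausdorffMeasure (E := EuclideanSpace ℝ (Fin d))
  rw [finrank_euclideanSpace_fin] at h0
  rw [Measure.isAddLeftInvariant_eq_smul (volume : Measure (EuclideanSpace ℝ (Fin d)))
    (Measure.hausdorffMeasure (d : ℝ))]
  have := hY.hausdorffMeasure_preimage_le (d := (d : ℝ)) (by positivity) s
  rw [ENNReal.rpow_natCast] at this
  simp only [Measure.smul_apply]
  rw [mul_smul_comm]
  gcongr

lemma hl_half {d : ℕ} (C : ℝ) (hC : 0 ≤ C) (v w : EuclideanSpace ℝ (Fin d) → ℝ) (B B' : ℝ)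
    (hB : ∀ x, |v x| ≤ B) (hB' : ∀ x, |w x| ≤ B') (hcv : Continuous v) (hcw : Continuous w)
    (hw : ConvexOn ℝ univ (fun x => w x + (C / 2) * ‖x‖ ^ 2)) :
    ∫⁻ x, ENNReal.ofReal (max (hopfLax d w 0 x - hopfLax d v 0 x) 0)
      ≤ ENNReal.ofReal ((1 + C) ^ d) * ∫⁻ x, ENNReal.ofReal (max (w x - v x) 0) := by
  choose Y hY using hl_max w hcw B' hB'
  have hA : AntilipschitzWith (1 + C).toNNReal Y := by
    refine AntilipschitzWith.of_le_mul_dist fun x x' => ?_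
    rw [Real.coe_toNNReal _ (by positivity), dist_eq_norm, dist_eq_norm]
    exact hl_anti C hC w hw x (Y x) x' (Y x') (hY x) (hY x')
  have hle : ∀ x, hopfLax d w 0 x - hopfLax d v 0 x ≤ w (Y x) - v (Y x) := by
    intro x
    have h1 : hopfLax d w 0 x ≤ w (Y x) - ‖x - Y x‖ ^ 2 / 2 := by
      rw [hl_eq]; exact ciSup_le (hY x)
    have h2 : v (Y x) - ‖x - Y x‖ ^ 2 / 2 ≤ hopfLax d v 0 x := by
      rw [hl_eq]; exact le_ciSup (hl_bdd v B hB x) (Y x)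
    linarith
  have hK : ENNReal.ofReal ((1 + C) ^ d) = ((1 + C).toNNReal : ENNReal) ^ d := by
    rw [ENNReal.ofReal_pow (by positivity)]; rfl
  have m1 := hl_meas w B' hB'
  have m2 := hl_meas v B hB
  rw [lintegral_eq_lintegral_meas_lt (f := fun x => max (hopfLax d w 0 x - hopfLax d v 0 x) 0) volume
      (Filter.Eventually.of_forall fun x => le_max_right _ _)
      (by fun_prop),
    lintegral_eq_lintegral_meas_lt (f := fun x => max (w x - v x) 0) volume
      (Filter.Eventually.of_forall fun x => le_max_right _ _)
      (by fun_prop), hK,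
    ← lintegral_const_mul' _ _ (by finiteness)]
  refine lintegral_mono fun t => ?_
  refine le_trans (measure_mono ?_) (hl_vol _ Y hA _)
  intro x hx
  simp only [mem_ofPred_eq, mem_preimage] at hx ⊢
  exact hx.trans_le (max_le_max (hle x) le_rfl)

/-- `L¹` stability of the Hopf–Lax solution at time `0` under a
perturbation `τ h` of the semiconvex terminal datum `v`:
`∫ |φ^τ(0,x) - φ(0,x)| dx ≤ τ e^{dC} ∫ |h| dx`. -/
theorem hopfLax_L1_stability
    (d : ℕ) (C : ℝ) (hC : 0 ≤ C)
    (v h : EuclideanSpace ℝ (Fin d) → ℝ) (B : ℝ) (L : NNReal)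
    (hB : ∀ x, |v x| ≤ B) (hL : LipschitzWith L v)
    (hv_sc : ConvexOn ℝ univ (fun x => v x + (C / 2) * ‖x‖ ^ 2))
    (hh_smooth : ContDiff ℝ 2 h) (hh_supp : HasCompactSupport h)
    (τ : ℝ) (hτ : τ ∈ Ioc (0 : ℝ) 1)
    (hvh_sc : ConvexOn ℝ univ (fun x => v x + τ * h x + (C / 2) * ‖x‖ ^ 2)) :
    ∫ x, |hopfLax d (fun y => v y + τ * h y) 0 x - hopfLax d v 0 x|
      ≤ τ * exp (d * C) * ∫ x, |h x| := by
  obtain ⟨hτ0, hτ1⟩ := hτ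
  have hhc : Continuous h := hh_smooth.continuous
  obtain ⟨M, hM⟩ : ∃ M, ∀ x, ‖h x‖ ≤ M := hh_supp.exists_bound_of_continuous hhc
  have hB' : ∀ x, |v x + τ * h x| ≤ B + τ * M := by
    intro x
    refine (abs_add_le _ _).trans (add_le_add (hB x) ?_)
    rw [abs_mul, abs_of_pos hτ0]
    exact mul_le_mul_of_nonneg_left (hM x) hτ0.le
  have hcv := hL.continuous
  have hcw : Continuous fun x => v x + τ * h x := by fun_prop
  have e1 := hl_half C hC v _ B _ hB hB' hcv hcw hvh_sc
  have e2 := hl_half C hC _ v _ B hB' hB hcw hcv hv_sc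
  have split : ∀ r s : ℝ, ENNReal.ofReal |r - s|
      = ENNReal.ofReal (max (r - s) 0) + ENNReal.ofReal (max (s - r) 0) := by
    intro r s
    rw [← ENNReal.ofReal_add (le_max_right _ _) (le_max_right _ _)]
    congr 1
    rcases le_total r s with hrs | hrs
    · rw [abs_of_nonpos (by linarith), max_eq_right (by linarith), max_eq_left (by linarith)]; ring
    · rw [abs_of_nonneg (by linarith), max_eq_left (by linarith), max_eq_right (by linarith)]; ring
  have m1 := hl_meas _ _ hB'
  have m2 := hl_meas _ _ hB
  have main : ∫⁻ x, ENNReal.ofReal |hopfLax d (fun y => v y + τ * h y) 0 x - hopfLax d v 0 x|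
      ≤ ENNReal.ofReal ((1 + C) ^ d) * ∫⁻ x, ENNReal.ofReal |v x + τ * h x - v x| := by
    simp only [split]
    rw [lintegral_add_left (by fun_prop),
      lintegral_add_left (by fun_prop), mul_add]
    exact add_le_add e1 e2
  have hint : Integrable (fun x => |h x|) := (hhc.integrable_of_hasCompactSupport hh_supp).abs
  have hI : ∫⁻ x, ENNReal.ofReal |v x + τ * h x - v x| = ENNReal.ofReal (τ * ∫ x, |h x|) := by
    rw [← integral_const_mul, ofReal_integral_eq_lintegral_ofReal (hint.const_mul τ)
      (Filter.Eventually.of_forall fun x => by positivity)]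
    refine lintegral_congr fun x => ?_
    rw [add_sub_cancel_left, abs_mul, abs_of_pos hτ0]
  have hI0 : 0 ≤ ∫ x, |h x| := integral_nonneg fun x => abs_nonneg _
  rw [hI, ← ENNReal.ofReal_mul (by positivity)] at main
  rw [integral_eq_lintegral_of_nonneg_ae (Filter.Eventually.of_forall fun x => abs_nonneg _)
    (Measurable.aestronglyMeasurable (by fun_prop))]
  refine (ENNReal.toReal_le_of_le_ofReal (by positivity) main).trans ?_
  have hexp : (1 + C) ^ d ≤ exp (d * C) := by
    rw [Real.exp_nat_mul]
    exact pow_le_pow_left₀ (by positivity) (by rw [add_comm]; exact Real.add_one_le_exp C) d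
  calc (1 + C) ^ d * (τ * ∫ x, |h x|) ≤ exp (d * C) * (τ * ∫ x, |h x|) := by gcongr
    _ = _ := by ring
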